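/- arXiv:2206.05576 — 2 statements merged into one kernel-verified Lean document; each statement's English description precedes it below -/
import Mathlib

section
/- Theorem 1(c) (worst-case complexity comparison of the two B&B designs): for all natural numbers N and L with 1 ≤ L ≤ N − 1, the worst-case number of SOCPs/SDRs solved by the proposed branch-and-bound, Q_Compute = C(N, L) + Σ_{i=2}^{N−L+1} C(N−i, L−1), does not exceed that of the alternative Boolean-variable formulation, Q′_Compute = 2·C(N, L) − 1; that is, C(N, L) + Σ_{i=2}^{N−L+1} C(N−i, L−1) ≤ 2·C(N, L) − 1, where C(n, k) denotes the binomial coefficient. -/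
/-- The hockey-stick identity, summed from the largest upper index downwards. -/
theorem sum_Icc_choose_sub (l d : ℕ) :
    ∑ i ∈ Finset.Icc 2 (d + 1), (l + 1 + d - i).choose l = (l + d).choose (l + 1) := by
  rcases d with _ | d
  · simp
  · rw [← add_assoc l d 1, ← Nat.sum_Icc_choose (l + d) l]
    refine Finset.sum_nbij' (fun i => l + 1 + (d + 1) - i) (fun m => l + 1 + (d + 1) - m)
      ?_ ?_ ?_ ?_ ?_ <;> intro i hi <;> simp only [Finset.mem_Icc] at hi ⊢ <;> omega

/-- Theorem 1(c): for `1 ≤ L ≤ N − 1`, the worst-case number of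
SOCPs/SDRs of the proposed B&B, `C(N,L) + ∑_{i=2}^{N−L+1} C(N−i, L−1)`, does
not exceed that of the alternative Boolean formulation, `2·C(N,L) − 1`. -/
theorem bb_worst_case_comparison (N L : ℕ) (hL1 : 1 ≤ L) (hLN : L ≤ N - 1) :
    N.choose L + ∑ i ∈ Finset.Icc 2 (N - L + 1), (N - i).choose (L - 1) ≤
      2 * N.choose L - 1 := by
  obtain ⟨l, rfl⟩ := Nat.exists_eq_add_of_le' hL1
  obtain ⟨d, rfl⟩ := Nat.exists_eq_add_of_le (show l + 1 ≤ N by omega)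
  rw [Nat.add_sub_cancel_left, Nat.add_sub_cancel, sum_Icc_choose_sub]
  have pascal : (l + 1 + d).choose (l + 1) = (l + d).choose l + (l + d).choose (l + 1) := by
    rw [Nat.add_right_comm, Nat.choose_succ_succ]
  have pos : 0 < (l + d).choose l := Nat.choose_pos (Nat.le_add_right l d)
  omega
end

section
/- GNN embedding norm bound (from the proof of Lemma 4): under the message-passing GNN recursion with ‖x_u‖₂ ≤ B_x, ‖e_{u,v}‖₂ ≤ B_x, ‖Z_i‖₂ ≤ B_Z, C_ξ-Lipschitz activation ξ with ξ(0) = 0, and neighbor sets 𝓔_u ⊆ {1,…,U}, the embeddings satisfy, for every vertex u and every depth D ≥ 0: ‖q_u^{(D)}‖₂ ≤ α^D·B_x + U·C_ξ²·B_Z·B_x·Σ_{k=0}^{D−1} α^k, where α = (1 + U·C_ξ)·C_ξ·B_Z (for α ≠ 1 the sum equals (α^D − 1)/(α − 1), giving the form stated in the paper). -/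
/-- One message-passing step maps embeddings bounded by `M` to embeddings bounded by an affine
function of `M`. -/
theorem norm_message_passing_step_le {V ι : Type*} [NormedAddCommGroup V] [NormedSpace ℝ V]
    [Fintype ι] {BZ Cξ Bx M : ℝ} (hBZ : 0 ≤ BZ) (hCξ : 0 ≤ Cξ) (hBx : 0 ≤ Bx) (hM : 0 ≤ M)
    {Z₁ Z₂ Z₃ : V →L[ℝ] V} (hZ₁ : ‖Z₁‖ ≤ BZ) (hZ₂ : ‖Z₂‖ ≤ BZ) (hZ₃ : ‖Z₃‖ ≤ BZ)
    {ξ : V → V} (hξ : ∀ a, ‖ξ a‖ ≤ Cξ * ‖a‖) {p : V} {q e : ι → V}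
    (hp : ‖p‖ ≤ M) (hq : ∀ v, ‖q v‖ ≤ M) (he : ∀ v, ‖e v‖ ≤ Bx) (s : Finset ι) :
    ‖ξ (Z₁ p + ∑ v ∈ s, ξ (Z₂ (q v) + Z₃ (e v)))‖ ≤
      (1 + Fintype.card ι * Cξ) * Cξ * BZ * M + Fintype.card ι * Cξ ^ 2 * BZ * Bx := by
  have hmsg (v : ι) : ‖ξ (Z₂ (q v) + Z₃ (e v))‖ ≤ Cξ * (BZ * M + BZ * Bx) :=
    (hξ _).trans <| mul_le_mul_of_nonneg_left
      (norm_add_le_of_le (Z₂.le_of_opNorm_le_of_le hZ₂ (hq v))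
        (Z₃.le_of_opNorm_le_of_le hZ₃ (he v))) hCξ
  have hsum : ‖∑ v ∈ s, ξ (Z₂ (q v) + Z₃ (e v))‖ ≤
      Fintype.card ι * (Cξ * (BZ * M + BZ * Bx)) := by
    calc ‖∑ v ∈ s, ξ (Z₂ (q v) + Z₃ (e v))‖
        ≤ ∑ _v ∈ s, Cξ * (BZ * M + BZ * Bx) := norm_sum_le_of_le _ fun v _ => hmsg v
      _ = s.card * (Cξ * (BZ * M + BZ * Bx)) := by simp
      _ ≤ Fintype.card ι * (Cξ * (BZ * M + BZ * Bx)) := by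
        gcongr
        exact s.card_le_univ
  calc ‖ξ (Z₁ p + ∑ v ∈ s, ξ (Z₂ (q v) + Z₃ (e v)))‖
      ≤ Cξ * (BZ * M + Fintype.card ι * (Cξ * (BZ * M + BZ * Bx))) :=
        (hξ _).trans <| mul_le_mul_of_nonneg_left
          (norm_add_le_of_le (Z₁.le_of_opNorm_le_of_le hZ₁ hp) hsum) hCξ
    _ = _ := by ring

/-- GNN embedding norm bound: under the message-passing GNN
recursion with bounded features, spectral-norm-bounded aggregation operators,
and a `C_ξ`-Lipschitz activation vanishing at `0`, the embeddings satisfy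
`‖q_u^{(D)}‖ ≤ α^D B_x + U C_ξ² B_Z B_x ∑_{k<D} α^k` with
`α = (1 + U C_ξ) C_ξ B_Z`. -/
theorem gnn_embedding_norm_bound (E U : ℕ) (hU : 1 ≤ U)
    (Bx BZ Cξ : ℝ) (hBx : 0 ≤ Bx) (hBZ : 0 ≤ BZ) (hCξ : 0 ≤ Cξ)
    (x : Fin U → EuclideanSpace ℝ (Fin E))
    (e : Fin U → Fin U → EuclideanSpace ℝ (Fin E))
    (𝓔 : Fin U → Finset (Fin U))
    (Z₁ Z₂ Z₃ : EuclideanSpace ℝ (Fin E) →L[ℝ] EuclideanSpace ℝ (Fin E))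
    (ξ : EuclideanSpace ℝ (Fin E) → EuclideanSpace ℝ (Fin E))
    (hx : ∀ u, ‖x u‖ ≤ Bx) (he : ∀ u v, ‖e u v‖ ≤ Bx)
    (hZ₁ : ‖Z₁‖ ≤ BZ) (hZ₂ : ‖Z₂‖ ≤ BZ) (hZ₃ : ‖Z₃‖ ≤ BZ)
    (hξ : ∀ a b, ‖ξ a - ξ b‖ ≤ Cξ * ‖a - b‖) (hξ0 : ξ 0 = 0)
    (q : ℕ → Fin U → EuclideanSpace ℝ (Fin E))
    (hq0 : ∀ u, q 0 u = x u)
    (hqrec : ∀ d u, q (d + 1) u =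
      ξ (Z₁ (q d u) + ∑ v ∈ 𝓔 u, ξ (Z₂ (q d v) + Z₃ (e u v)))) :
    ∀ u D, ‖q D u‖ ≤ ((1 + U * Cξ) * Cξ * BZ) ^ D * Bx +
      U * Cξ ^ 2 * BZ * Bx * ∑ k ∈ Finset.range D, ((1 + U * Cξ) * Cξ * BZ) ^ k := by
  have hξ' (a : EuclideanSpace ℝ (Fin E)) : ‖ξ a‖ ≤ Cξ * ‖a‖ := by
    simpa [hξ0] using hξ a 0
  intro u D
  induction D generalizing u with
  | zero => simpa [hq0] using hx u
  | succ d ih =>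
    rw [hqrec, geom_sum_succ]
    have hstep := norm_message_passing_step_le hBZ hCξ hBx ((norm_nonneg _).trans (ih u))
      hZ₁ hZ₂ hZ₃ hξ' (ih u) ih (he u) (𝓔 u)
    rw [Fintype.card_fin] at hstep
    exact hstep.trans_eq (by ring)
end
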